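/- arXiv:2104.09816 — 2 statements merged into one kernel-verified Lean document; each statement's English description precedes it below -/
import Mathlib

section
/- If two pointed relational models (M1,w1) and (M2,w2) are point sabotage bisimilar (d-bisimilar), then they satisfy exactly the same formulas of point sabotage logic PSL: for every PSL formula φ, (M1,w1) ⊨ φ if and only if (M2,w2) ⊨ φ. -/
/-- A relational model with an explicit set of worlds `dom`, a relation and a
valuation of propositional letters `P`. -/
structure PModel (α P : Type*) where
  dom : Set α
  rel : Set (α × α)
  val : P → Set α

variable {α β P : Type*}

/-- `M ∖ {v}`: the model obtained from `M` by deleting the world `v`,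
removing all edges incident with `v` and removing `v` from the valuation. -/
def PModel.delPoint (M : PModel α P) (v : α) : PModel α P :=
  ⟨M.dom \ {v}, {e ∈ M.rel | e.1 ≠ v ∧ e.2 ≠ v}, fun p => M.val p \ {v}⟩

/-- Formulas of point sabotage logic (PSL):
`φ ::= p | ¬φ | φ∧φ | ◇φ | ⟨−⟩φ`. -/
inductive PForm (P : Type*) where
  | atom : P → PForm P
  | neg : PForm P → PForm P
  | and : PForm P → PForm P → PForm P
  | dia : PForm P → PForm P
  | rem : PForm P → PForm P

/-- Truth of a PSL formula at a pointed model.  In particular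
`(M,w) ⊨ ⟨−⟩φ` iff there is a world `v ≠ w` with `(M∖{v}, w) ⊨ φ`. -/
def PModel.Sat : PModel α P → α → PForm P → Prop
  | M, w, .atom p => w ∈ M.val p
  | M, w, .neg φ => ¬ M.Sat w φ
  | M, w, .and φ ψ => M.Sat w φ ∧ M.Sat w ψ
  | M, w, .dia φ => ∃ v, (w, v) ∈ M.rel ∧ M.Sat v φ
  | M, w, .rem φ => ∃ v ∈ M.dom, v ≠ w ∧ (M.delPoint v).Sat w φ

/-- `Z` is a point sabotage bisimulation between pointed models. -/
def IsDBisim (Z : PModel α P → α → PModel β P → β → Prop) : Prop :=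
  ∀ M1 w1 M2 w2, Z M1 w1 M2 w2 →
    (∀ p, w1 ∈ M1.val p ↔ w2 ∈ M2.val p) ∧
    (∀ v1, (w1, v1) ∈ M1.rel → ∃ v2, (w2, v2) ∈ M2.rel ∧ Z M1 v1 M2 v2) ∧
    (∀ v2, (w2, v2) ∈ M2.rel → ∃ v1, (w1, v1) ∈ M1.rel ∧ Z M1 v1 M2 v2) ∧
    (∀ u1 ∈ M1.dom, u1 ≠ w1 → ∃ u2 ∈ M2.dom, u2 ≠ w2 ∧
      Z (M1.delPoint u1) w1 (M2.delPoint u2) w2) ∧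
    (∀ u2 ∈ M2.dom, u2 ≠ w2 → ∃ u1 ∈ M1.dom, u1 ≠ w1 ∧
      Z (M1.delPoint u1) w1 (M2.delPoint u2) w2)

/-- Two pointed models are point sabotage bisimilar (d-bisimilar). -/
def DBisimilar (M1 : PModel α P) (w1 : α) (M2 : PModel β P) (w2 : β) : Prop :=
  ∃ Z, IsDBisim Z ∧ Z M1 w1 M2 w2

/-- Pointed models linked by a point sabotage bisimulation satisfy the same PSL
formulas. -/
theorem IsDBisim.sat_iff {Z : PModel α P → α → PModel β P → β → Prop} (hZ : IsDBisim Z)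
    {M1 : PModel α P} {w1 : α} {M2 : PModel β P} {w2 : β} (h : Z M1 w1 M2 w2)
    (φ : PForm P) : M1.Sat w1 φ ↔ M2.Sat w2 φ := by
  induction φ generalizing M1 w1 M2 w2 with
  | atom p => simpa only [PModel.Sat] using (hZ _ _ _ _ h).1 p
  | neg φ ih => simpa only [PModel.Sat] using not_congr (ih h)
  | and φ ψ ihφ ihψ => simpa only [PModel.Sat] using and_congr (ihφ h) (ihψ h)
  | dia φ ih =>
    obtain ⟨-, zig, zag, -, -⟩ := hZ _ _ _ _ h
    simp only [PModel.Sat]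
    constructor
    · rintro ⟨v1, hv1, hs⟩
      obtain ⟨v2, hv2, hz⟩ := zig v1 hv1
      exact ⟨v2, hv2, (ih hz).1 hs⟩
    · rintro ⟨v2, hv2, hs⟩
      obtain ⟨v1, hv1, hz⟩ := zag v2 hv2
      exact ⟨v1, hv1, (ih hz).2 hs⟩
  | rem φ ih =>
    obtain ⟨-, -, -, zig, zag⟩ := hZ _ _ _ _ h
    simp only [PModel.Sat]
    constructor
    · rintro ⟨u1, hu1, hne, hs⟩
      obtain ⟨u2, hu2, hne', hz⟩ := zig u1 hu1 hne
      exact ⟨u2, hu2, hne', (ih hz).1 hs⟩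
    · rintro ⟨u2, hu2, hne, hs⟩
      obtain ⟨u1, hu1, hne', hz⟩ := zag u2 hu2 hne
      exact ⟨u1, hu1, hne', (ih hz).2 hs⟩

/-- If two pointed models are point sabotage bisimilar, then they satisfy the
same PSL formulas. -/
theorem dbisimilar_iff_sat (M1 : PModel α P) (w1 : α) (M2 : PModel β P) (w2 : β)
    (h : DBisimilar M1 w1 M2 w2) :
    ∀ φ : PForm P, M1.Sat w1 φ ↔ M2.Sat w2 φ := by
  obtain ⟨Z, hZ, hz⟩ := h
  exact hZ.sat_iff hz
end

section
/- Suppose M has n edges and (N',t) is an expansion of (N,t) satisfying K(M) with p_s true at t. Then for any sequence (j1,…,jl) of pairwise distinct edges of N with 0 ≤ l ≤ n, if there is a path t0 → t1 → ⋯ → tk in N_(j1,…,jl) with t0 reachable from t in N, then there exist a sequence (d1,…,dl) of pairwise distinct edges of M with p_{d_m(1)} true at j_m(1) and p_{d_m(2)} true at j_m(2) in N' for each 1 ≤ m ≤ l, and a path s0 → s1 → ⋯ → sk in M_(d1,…,dl) with s0 reachable from s in M, such that for each i ∈ [0,k] and each original propositional letter p, s_i ∈ V1(p) iff t_i ∈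 V2(p). -/
/-! Infrastructure for generalized sabotage modal logic (GSML) over finite
models. -/

/-- A finite relational model: a finite relation on worlds `α` and a valuation
of propositional letters `P`. -/
structure FinModel (α P : Type*) where
  rel : Finset (α × α)
  val : P → Finset α

variable {α β P : Type*}

/-- The model obtained from `M` by deleting the edge `e`. -/
def FinModel.delEdge [DecidableEq α] (M : FinModel α P) (e : α × α) :
    FinModel α P :=
  ⟨M.rel.erase e, M.val⟩

/-- The model obtained from `M` by deleting the edges in `d` (in order). -/
def FinModel.delEdges [DecidableEq α] (M : FinModel α P) (d : List (α × α)) :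
    FinModel α P :=
  d.foldl FinModel.delEdge M

/-- Formulas of generalized sabotage modal logic (GSML), with verum:
`φ ::= ⊤ | p | ¬φ | φ∧φ | ◇φ | ◆^ψ_χ φ`. -/
inductive GForm (Q : Type*) where
  | top : GForm Q
  | atom : Q → GForm Q
  | neg : GForm Q → GForm Q
  | and : GForm Q → GForm Q → GForm Q
  | dia : GForm Q → GForm Q
  | gsab : GForm Q → GForm Q → GForm Q → GForm Q

namespace GForm

variable {Q : Type*}

/-- Falsum. -/
def bot : GForm Q := .neg .top

/-- Disjunction, defined from `¬` and `∧`. -/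
def or (φ ψ : GForm Q) : GForm Q := .neg (.and (.neg φ) (.neg ψ))

/-- Implication, defined from `¬` and `∧`. -/
def imp (φ ψ : GForm Q) : GForm Q := .neg (.and φ (.neg ψ))

/-- `□`, the dual of `◇`. -/
def box (φ : GForm Q) : GForm Q := .neg (.dia (.neg φ))

/-- `■^ψ_χ`, the dual of `◆^ψ_χ`. -/
def gboxSab (ψ χ φ : GForm Q) : GForm Q := .neg (.gsab ψ χ (.neg φ))

/-- Finite conjunction. -/
def bigAnd (l : List (GForm Q)) : GForm Q := l.foldr .and .top

/-- Finite disjunction. -/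
def bigOr (l : List (GForm Q)) : GForm Q := l.foldr or bot

end GForm

/-- Truth of a GSML formula at a pointed model.  In particular
`(M,w) ⊨ ◆^ψ_χ φ` iff there is an edge `(u,v) ∈ R` with `(M,u) ⊨ ψ`,
`(M,v) ⊨ χ`, and `φ` true at `w` after deleting `(u,v)`. -/
def FinModel.Sat [DecidableEq α] : FinModel α P → α → GForm P → Prop
  | _, _, .top => True
  | M, w, .atom p => w ∈ M.val p
  | M, w, .neg φ => ¬ M.Sat w φ
  | M, w, .and φ ψ => M.Sat w φ ∧ M.Sat w ψ
  | M, w, .dia φ => ∃ v, (w, v) ∈ M.rel ∧ M.Sat v φ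
  | M, w, .gsab ψ χ φ =>
      ∃ e ∈ M.rel, M.Sat e.1 ψ ∧ M.Sat e.2 χ ∧ (M.delEdge e).Sat w φ

section CharFormula

variable [Fintype α] [DecidableEq α] [Fintype P]

/-- `AT_x`: the conjunction of all literals over the original letters that are
true at `(M,x)`. -/
noncomputable def ATx (M : FinModel α P) (x : α) : GForm (P ⊕ α) :=
  GForm.bigAnd ((Finset.univ : Finset P).toList.map fun p =>
    if x ∈ M.val p then .atom (.inl p) else .neg (.atom (.inl p)))

/-- The list of successors of `x` in `M`. -/
noncomputable def succList (M : FinModel α P) (x : α) : List α :=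
  (Finset.univ.filter fun y => (x, y) ∈ M.rel).toList

/-- `env(M,x) = ⋀_{y : R x y} ◇p_y ∧ □ ⋁_{y : R x y} p_y`. -/
noncomputable def envF (M : FinModel α P) (x : α) : GForm (P ⊕ α) :=
  .and (GForm.bigAnd ((succList M x).map fun y => .dia (.atom (.inr y))))
    (GForm.box (GForm.bigOr ((succList M x).map fun y => .atom (.inr y))))

/-- `E(M) = ⋀_x (p_x → AT_x ∧ env(M,x))`. -/
noncomputable def EF (M : FinModel α P) : GForm (P ⊕ α) :=
  GForm.bigAnd ((Finset.univ : Finset α).toList.map fun x =>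
    GForm.imp (.atom (.inr x)) (.and (ATx M x) (envF M x)))

/-- All sequences of pairwise distinct elements of `es` of length `k`. -/
def distinctSeqs {E : Type*} [DecidableEq E] (es : List E) : ℕ → List (List E)
  | 0 => [[]]
  | k + 1 => es.flatMap fun e =>
      (distinctSeqs es k).filterMap fun d => if e ∈ d then none else some (e :: d)

/-- `◆^{p_{i1(1)}}_{p_{i1(2)}} ⋯ ◆^{p_{ik(1)}}_{p_{ik(2)}} φ`, the nested
labelled sabotage modalities along the edge sequence `d`. -/
def gsabSeq (d : List (α × α)) (φ : GForm (P ⊕ α)) : GForm (P ⊕ α) :=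
  d.foldr (fun e acc => .gsab (.atom (.inr e.1)) (.atom (.inr e.2)) acc) φ

/-- `■^{p_{i1(1)}}_{p_{i1(2)}} ⋯ ■^{p_{ik(1)}}_{p_{ik(2)}} φ`, the nested
dual labelled sabotage modalities along the edge sequence `d`. -/
def gboxSeq (d : List (α × α)) (φ : GForm (P ⊕ α)) : GForm (P ⊕ α) :=
  d.foldr (fun e acc => GForm.gboxSab (.atom (.inr e.1)) (.atom (.inr e.2)) acc) φ

/-- `K_k(M) = ⋀_{P_(i1,…,ik)} (◆^{p_{i1(1)}}_{p_{i1(2)}} ⋯ E(M_(i1,…,ik)) ∧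
■^{p_{i1(1)}}_{p_{i1(2)}} ⋯ ⋁_{P_(i1,…,ik)} E(M_(i1,…,ik)))`. -/
noncomputable def KkF (M : FinModel α P) (k : ℕ) : GForm (P ⊕ α) :=
  .and (GForm.bigAnd ((distinctSeqs M.rel.toList k).map fun d =>
      gsabSeq d (EF (M.delEdges d))))
    (GForm.bigAnd ((distinctSeqs M.rel.toList k).map fun d =>
      gboxSeq d (GForm.bigOr ((distinctSeqs M.rel.toList k).map fun d' =>
        EF (M.delEdges d')))))

/-- `K(M) = E(M) ∧ ⋀_{1 ≤ i ≤ n} K_i(M) ∧ ¬(◆^⊤_⊤)^{n+1}⊤`, where `n` is the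
number of edges of `M`. -/
noncomputable def KF (M : FinModel α P) : GForm (P ⊕ α) :=
  .and (EF M)
    (GForm.bigAnd (((List.range M.rel.card).map fun i => KkF M (i + 1)) ++
      [.neg ((fun φ => GForm.gsab .top .top φ)^[M.rel.card + 1] .top)]))

end CharFormula

/-- The expansion of `N` interpreting each fresh letter `p_x` (for `x : α`)
as the set `f x`, keeping the relation and the original valuation unchanged. -/
def FinModel.expand (N : FinModel β P) (f : α → Finset β) :
    FinModel β (P ⊕ α) :=
  ⟨N.rel, fun q => Sum.elim N.val f q⟩

/-- A path `x0 → x1 → ⋯ → xk` in a model: consecutive points are related by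
the model's relation. -/
def FinModel.IsPath (M : FinModel α P) (xs : List α) : Prop :=
  xs.Chain' fun a b => (a, b) ∈ M.rel

/-- `y` is reachable from `x` in `M` by a (possibly empty) path. -/
def FinModel.Reach (M : FinModel α P) (x y : α) : Prop :=
  Relation.ReflTransGen (fun a b => (a, b) ∈ M.rel) x y

section Semantics

variable {Q : Type*} [DecidableEq α]

theorem FinModel.sat_or (M : FinModel α Q) (w : α) (φ ψ : GForm Q) :
    M.Sat w (GForm.or φ ψ) ↔ M.Sat w φ ∨ M.Sat w ψ := by
  simp only [GForm.or, FinModel.Sat]; tauto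

theorem FinModel.sat_imp (M : FinModel α Q) (w : α) (φ ψ : GForm Q) :
    M.Sat w (GForm.imp φ ψ) ↔ (M.Sat w φ → M.Sat w ψ) := by
  simp only [GForm.imp, FinModel.Sat]; tauto

theorem FinModel.sat_box (M : FinModel α Q) (w : α) (φ : GForm Q) :
    M.Sat w (GForm.box φ) ↔ ∀ v, (w, v) ∈ M.rel → M.Sat v φ := by
  simp [GForm.box, FinModel.Sat]

theorem FinModel.sat_bigAnd (M : FinModel α Q) (w : α) (l : List (GForm Q)) :
    M.Sat w (GForm.bigAnd l) ↔ ∀ φ ∈ l, M.Sat w φ := by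
  induction l with
  | nil => simp [GForm.bigAnd, FinModel.Sat]
  | cons φ l ih =>
    rw [List.forall_mem_cons, ← ih]
    rfl

theorem FinModel.sat_bigOr (M : FinModel α Q) (w : α) (l : List (GForm Q)) :
    M.Sat w (GForm.bigOr l) ↔ ∃ φ ∈ l, M.Sat w φ := by
  induction l with
  | nil => simp [GForm.bigOr, GForm.bot, FinModel.Sat]
  | cons φ l ih =>
    rw [List.exists_mem_cons_iff, ← ih]
    exact M.sat_or w φ _

theorem FinModel.mem_delEdges_rel (M : FinModel α Q) (d : List (α × α)) (e : α × α) :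
    e ∈ (M.delEdges d).rel ↔ e ∈ M.rel ∧ e ∉ d := by
  induction d generalizing M with
  | nil => simp [FinModel.delEdges]
  | cons a d ih =>
    have h := ih (M.delEdge a)
    simp only [FinModel.delEdges, List.foldl_cons] at h ⊢
    rw [h]
    simp only [FinModel.delEdge, Finset.mem_erase, List.mem_cons]
    tauto

theorem FinModel.delEdges_val (M : FinModel α Q) (d : List (α × α)) :
    (M.delEdges d).val = M.val := by
  induction d generalizing M with
  | nil => rfl
  | cons a d ih => exact ih (M.delEdge a)

/-- Repeated unlabelled sabotage succeeds as long as there are enough edges. -/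
theorem FinModel.sat_iterate_gsab (M : FinModel α Q) (w : α) (k : ℕ) (hk : k ≤ M.rel.card) :
    M.Sat w ((fun φ => GForm.gsab .top .top φ)^[k] .top) := by
  induction k generalizing M with
  | zero => trivial
  | succ k ih =>
    rw [Function.iterate_succ_apply']
    obtain ⟨e, he⟩ := Finset.card_pos.1 (by omega : 0 < M.rel.card)
    refine ⟨e, he, trivial, trivial, ih (M.delEdge e) ?_⟩
    simp only [FinModel.delEdge, Finset.card_erase_of_mem he]
    omega

end Semantics

theorem FinModel.exists_of_sat_gsabSeq [DecidableEq β] (N : FinModel β (P ⊕ α)) (w : β)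
    (d : List (α × α)) (φ : GForm (P ⊕ α)) (h : N.Sat w (gsabSeq d φ)) :
    ∃ j : List (β × β), j.Nodup ∧ (∀ e ∈ j, e ∈ N.rel) ∧
      List.Forall₂ (fun dm jm => jm.1 ∈ N.val (.inr dm.1) ∧ jm.2 ∈ N.val (.inr dm.2)) d j ∧
      (N.delEdges j).Sat w φ := by
  induction d generalizing N with
  | nil => exact ⟨[], by simp, by simp, .nil, h⟩
  | cons a d ih =>
    obtain ⟨e, he, h1, h2, h3⟩ := h
    obtain ⟨j, hnd, hmem, hlab, hsat⟩ := ih (N.delEdge e) h3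
    have hmem' : ∀ e' ∈ j, e' ≠ e ∧ e' ∈ N.rel := fun e' he' => Finset.mem_erase.1 (hmem e' he')
    refine ⟨e :: j, List.nodup_cons.2 ⟨fun hej => (hmem' e hej).1 rfl, hnd⟩, ?_,
      .cons ⟨h1, h2⟩ hlab, hsat⟩
    exact List.forall_mem_cons.2 ⟨he, fun e' he' => (hmem' e' he').2⟩

theorem FinModel.sat_of_sat_gboxSeq [DecidableEq β] (N : FinModel β (P ⊕ α)) (w : β)
    (d : List (α × α)) (φ : GForm (P ⊕ α)) (h : N.Sat w (gboxSeq d φ))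
    (j : List (β × β)) (hnd : j.Nodup) (hmem : ∀ e ∈ j, e ∈ N.rel)
    (hlab : List.Forall₂ (fun dm jm => jm.1 ∈ N.val (.inr dm.1) ∧ jm.2 ∈ N.val (.inr dm.2)) d j) :
    (N.delEdges j).Sat w φ := by
  induction d generalizing N j with
  | nil => cases hlab; exact h
  | cons a d ih =>
    obtain _ | @⟨_, e, _, j, hae, hlab⟩ := hlab
    rw [List.nodup_cons] at hnd
    rw [List.forall_mem_cons] at hmem
    refine ih (N.delEdge e) ?_ j hnd.2 (fun e' he' => Finset.mem_erase.2
      ⟨fun heq => hnd.1 (heq ▸ he'), hmem.2 e' he'⟩) hlab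
    by_contra hcon
    exact h ⟨e, hmem.1, hae.1, hae.2, hcon⟩

theorem mem_distinctSeqs {E : Type*} [DecidableEq E] (es : List E) (k : ℕ) (d : List E) :
    d ∈ distinctSeqs es k ↔ d.length = k ∧ d.Nodup ∧ ∀ e ∈ d, e ∈ es := by
  induction k generalizing d with
  | zero =>
    simp only [distinctSeqs, List.mem_singleton, List.length_eq_zero_iff]
    constructor
    · rintro rfl; simp
    · exact And.left
  | succ k ih =>
    simp only [distinctSeqs, List.mem_flatMap, List.mem_filterMap]
    constructor
    · rintro ⟨e, he, d', hd', h⟩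
      split_ifs at h with hed
      obtain rfl := Option.some.inj h
      obtain ⟨h1, h2, h3⟩ := (ih d').1 hd'
      exact ⟨by simp [h1], List.nodup_cons.2 ⟨hed, h2⟩, List.forall_mem_cons.2 ⟨he, h3⟩⟩
    · rintro ⟨h1, h2, h3⟩
      cases d with
      | nil => simp at h1
      | cons e d =>
        rw [List.nodup_cons] at h2
        rw [List.forall_mem_cons] at h3
        exact ⟨e, h3.1, d, (ih d).2 ⟨by simpa using h1, h2.2, h3.2⟩, by simp [h2.1]⟩

/-- A labelled matching of two duplicate-free lists yields an injective relabelling map. -/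
theorem exists_injOn_of_forall₂ {A B : Type*} [DecidableEq B] [Nonempty A] {r : A → B → Prop}
    {d : List A} {j : List B} (h : List.Forall₂ r d j) (hd : d.Nodup) (hj : j.Nodup) :
    ∃ g : B → A, (∀ b ∈ j, g b ∈ d ∧ r (g b) b) ∧ Set.InjOn g {b | b ∈ j} := by
  induction h with
  | nil => exact ⟨fun _ => Classical.arbitrary A, by simp, by simp⟩
  | @cons a b d j hab _ ih =>
    rw [List.nodup_cons] at hd hj
    obtain ⟨g, hg, hinj⟩ := ih hd.2 hj.2
    have hne : ∀ b' ∈ j, b' ≠ b := fun b' hb' heq => hj.1 (heq ▸ hb')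
    refine ⟨Function.update g b a, ?_, ?_⟩
    · rintro b' hb'
      rcases List.mem_cons.1 hb' with rfl | hb'
      · simp [hab]
      · rw [Function.update_of_ne (hne b' hb')]
        exact ⟨List.mem_cons_of_mem _ (hg b' hb').1, (hg b' hb').2⟩
    · intro x hx y hy hxy
      rcases List.mem_cons.1 hx with hxb | hx' <;> rcases List.mem_cons.1 hy with hyb | hy'
      · rw [hxb, hyb]
      · rw [hxb, Function.update_self, Function.update_of_ne (hne y hy')] at hxy
        exact absurd (hxy ▸ (hg y hy').1) hd.1
      · rw [hyb, Function.update_self, Function.update_of_ne (hne x hx')] at hxy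
        exact absurd (hxy ▸ (hg x hx').1) hd.1
      · rw [Function.update_of_ne (hne x hx'), Function.update_of_ne (hne y hy')] at hxy
        exact hinj hx' hy' hxy

section CharFormula

variable [Fintype α] [DecidableEq α] [Fintype P] [DecidableEq β]

/-- The consequences of `E(M)` at a world carrying the label `p_x`. -/
theorem FinModel.of_sat_EF {M : FinModel α P} {N : FinModel β (P ⊕ α)} {w : β}
    (h : N.Sat w (EF M)) {x : α} (hx : w ∈ N.val (.inr x)) :
    (∀ p, x ∈ M.val p ↔ w ∈ N.val (.inl p)) ∧
      ((∃ y, (x, y) ∈ M.rel) ↔ ∃ v, (w, v) ∈ N.rel) := by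
  rw [EF, FinModel.sat_bigAnd] at h
  have h' := h _ (List.mem_map_of_mem (Finset.mem_toList.2 (Finset.mem_univ x)))
  rw [FinModel.sat_imp] at h'
  obtain ⟨hat, hdia, hbox⟩ := h' hx
  rw [ATx, FinModel.sat_bigAnd] at hat
  rw [FinModel.sat_bigAnd] at hdia
  rw [FinModel.sat_box] at hbox
  refine ⟨fun p => ?_, ?_, ?_⟩
  · have := hat _ (List.mem_map_of_mem (Finset.mem_toList.2 (Finset.mem_univ p)))
    split_ifs at this with hp
    · exact ⟨fun _ => this, fun _ => hp⟩
    · exact ⟨fun h => absurd h hp, fun h => absurd h this⟩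
  · rintro ⟨y, hy⟩
    obtain ⟨v, hv, -⟩ := hdia _ (List.mem_map_of_mem (a := y) (by simpa [succList] using hy))
    exact ⟨v, hv⟩
  · rintro ⟨v, hv⟩
    obtain ⟨φ, hφ, -⟩ := (FinModel.sat_bigOr _ _ _).1 (hbox v hv)
    obtain ⟨y, hy, -⟩ := List.mem_map.1 hφ
    exact ⟨y, by simpa [succList] using hy⟩

/-- Deletions in `M` are matched by label-respecting deletions in a model of `K(M)`. -/
theorem FinModel.exists_matching_of_sat_KF {M : FinModel α P} {N : FinModel β (P ⊕ α)} {w : β}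
    (h : N.Sat w (KF M)) {d : List (α × α)} (hd : d.Nodup) (hdM : ∀ e ∈ d, e ∈ M.rel) :
    ∃ j : List (β × β), j.Nodup ∧ (∀ e ∈ j, e ∈ N.rel) ∧
      List.Forall₂ (fun dm jm => jm.1 ∈ N.val (.inr dm.1) ∧ jm.2 ∈ N.val (.inr dm.2)) d j ∧
      (N.delEdges j).Sat w (EF (M.delEdges d)) := by
  have hlen : d.length ≤ M.rel.card := by
    rw [← List.toFinset_card_of_nodup hd]
    exact Finset.card_le_card fun e he => hdM e (List.mem_toFinset.1 he)
  apply FinModel.exists_of_sat_gsabSeq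
  obtain ⟨hE, hKs⟩ := h
  cases d with
  | nil => exact hE
  | cons a d =>
    rw [FinModel.sat_bigAnd] at hKs
    have hk := hKs (KkF M (d.length + 1)) (List.mem_append_left _
      (List.mem_map.2 ⟨d.length, List.mem_range.2 (by simpa using hlen), rfl⟩))
    exact (FinModel.sat_bigAnd _ _ _).1 hk.1 _ (List.mem_map.2
      ⟨a :: d, (mem_distinctSeqs _ _ _).2 ⟨by simp, hd, by simpa using hdM⟩, rfl⟩)

/-- Labelled deletions in a model of `K(M)` are answered by equally many deletions in `M`. -/
theorem FinModel.exists_delEdges_of_sat_KF {M : FinModel α P} {N : FinModel β (P ⊕ α)} {w : β}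
    (h : N.Sat w (KF M)) {d : List (α × α)} (hd : d.Nodup) (hdM : ∀ e ∈ d, e ∈ M.rel)
    {j : List (β × β)} (hj : j.Nodup) (hjN : ∀ e ∈ j, e ∈ N.rel)
    (hlab : List.Forall₂
      (fun dm jm => jm.1 ∈ N.val (.inr dm.1) ∧ jm.2 ∈ N.val (.inr dm.2)) d j) :
    ∃ d' : List (α × α), d'.length = j.length ∧
      (N.delEdges j).Sat w (EF (M.delEdges d')) := by
  have hlen : d.length ≤ M.rel.card := by
    rw [← List.toFinset_card_of_nodup hd]
    exact Finset.card_le_card fun e he => hdM e (List.mem_toFinset.1 he)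
  have hdj := hlab.length_eq
  obtain ⟨hE, hKs⟩ := h
  cases d with
  | nil =>
    cases hlab
    exact ⟨[], rfl, hE⟩
  | cons a d =>
    rw [FinModel.sat_bigAnd] at hKs
    have hk := hKs (KkF M (d.length + 1)) (List.mem_append_left _
      (List.mem_map.2 ⟨d.length, List.mem_range.2 (by simpa using hlen), rfl⟩))
    have hbox := (FinModel.sat_bigAnd _ _ _).1 hk.2 _ (List.mem_map.2
      ⟨a :: d, (mem_distinctSeqs _ _ _).2 ⟨by simp, hd, by simpa using hdM⟩, rfl⟩)
    have hor := FinModel.sat_of_sat_gboxSeq _ _ _ _ hbox j hj hjN hlab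
    obtain ⟨φ, hφ, hsat⟩ := (FinModel.sat_bigOr _ _ _).1 hor
    obtain ⟨d', hd', rfl⟩ := List.mem_map.1 hφ
    exact ⟨d', by rw [((mem_distinctSeqs _ _ _).1 hd').1, ← hdj]; simp, hsat⟩

theorem FinModel.card_rel_le_of_sat_KF {M : FinModel α P} {N : FinModel β (P ⊕ α)} {w : β}
    (h : N.Sat w (KF M)) : N.rel.card ≤ M.rel.card := by
  by_contra! hlt
  exact (FinModel.sat_bigAnd _ _ _).1 h.2 _ (List.mem_append_right _ (List.mem_singleton.2 rfl))
    (N.sat_iterate_gsab w _ hlt)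

/-- The edges of a model of `K(M)` embed into those of `M` compatibly with the labels. -/
theorem FinModel.exists_edge_map_of_sat_KF [Nonempty α] {M : FinModel α P}
    {N : FinModel β (P ⊕ α)} {w : β} (h : N.Sat w (KF M)) :
    ∃ g : β × β → α × α, (∀ e ∈ N.rel, g e ∈ M.rel ∧
        e.1 ∈ N.val (.inr (g e).1) ∧ e.2 ∈ N.val (.inr (g e).2)) ∧
      Set.InjOn g N.rel := by
  obtain ⟨j, hj, hjN, hlab, -⟩ := FinModel.exists_matching_of_sat_KF h
    (Finset.nodup_toList M.rel) (fun e he => Finset.mem_toList.1 he)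
  have hcard : j.toFinset = N.rel := by
    apply Finset.eq_of_subset_of_card_le (fun e he => hjN e (List.mem_toFinset.1 he))
    rw [List.toFinset_card_of_nodup hj, ← hlab.length_eq, Finset.length_toList]
    exact FinModel.card_rel_le_of_sat_KF h
  have hmem : ∀ e, e ∈ N.rel ↔ e ∈ j := fun e => by rw [← hcard, List.mem_toFinset]
  obtain ⟨g, hg, hinj⟩ := exists_injOn_of_forall₂ hlab (Finset.nodup_toList M.rel) hj
  refine ⟨g, fun e he => ?_, fun e he e' he' => hinj ((hmem e).1 he) ((hmem e').1 he')⟩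
  obtain ⟨h1, h2⟩ := hg e ((hmem e).1 he)
  exact ⟨Finset.mem_toList.1 h1, h2⟩

/-- In a model of `K(M)`, a world labelled `p_x` has at most as many outgoing edges as `x`. -/
theorem FinModel.card_filter_fst_le_of_sat_KF {M : FinModel α P} {N : FinModel β (P ⊕ α)} {w : β}
    (h : N.Sat w (KF M)) {x : α} (hx : w ∈ N.val (.inr x)) :
    (N.rel.filter (·.1 = w)).card ≤ (M.rel.filter (·.1 = x)).card := by
  obtain ⟨j, hj, -, hlab, hsat⟩ := FinModel.exists_matching_of_sat_KF h
    (Finset.nodup_toList (M.rel.filter (·.1 = x)))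
    (fun e he => (Finset.mem_filter.1 (Finset.mem_toList.1 he)).1)
  have hiff := (FinModel.of_sat_EF hsat (x := x) (by rwa [FinModel.delEdges_val])).2
  have hsub : N.rel.filter (·.1 = w) ⊆ j.toFinset := by
    rintro ⟨u, v⟩ he
    obtain ⟨huv, rfl⟩ := Finset.mem_filter.1 he
    by_contra hej
    obtain ⟨y, hy⟩ := hiff.2 ⟨v, (FinModel.mem_delEdges_rel _ _ _).2
      ⟨huv, fun hmem => hej (List.mem_toFinset.2 hmem)⟩⟩
    rw [FinModel.mem_delEdges_rel] at hy
    exact hy.2 (by simpa using hy.1)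
  calc _ ≤ j.toFinset.card := Finset.card_le_card hsub
    _ = _ := by rw [List.toFinset_card_of_nodup hj, ← hlab.length_eq, Finset.length_toList]

/-- In a model of `K(M)`, a world with an outgoing edge carries at most one label. -/
theorem FinModel.label_unique_of_sat_KF {M : FinModel α P} {N : FinModel β (P ⊕ α)} {w : β}
    (h : N.Sat w (KF M)) {v : β} (hv : (w, v) ∈ N.rel) {x x' : α}
    (hx : w ∈ N.val (.inr x)) (hx' : w ∈ N.val (.inr x')) : x = x' := by
  by_contra hne
  have : Nonempty α := ⟨x⟩
  obtain ⟨g, hg, hinj⟩ := FinModel.exists_edge_map_of_sat_KF h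
  set S := N.rel.filter (·.1 = w) with hS
  have hSN : ∀ e ∈ S.toList, e ∈ N.rel := fun e he =>
    (Finset.mem_filter.1 (Finset.mem_toList.1 he)).1
  obtain ⟨d', hlen, hsat⟩ := FinModel.exists_delEdges_of_sat_KF h (d := S.toList.map g)
    (j := S.toList)
    (List.Nodup.map_on (fun e he e' he' => hinj (hSN e he) (hSN e' he')) S.nodup_toList)
    (by
      intro e he
      obtain ⟨e, heS, rfl⟩ := List.mem_map.1 he
      exact (hg e (hSN e heS)).1)
    S.nodup_toList hSN
    (List.forall₂_map_left_iff.2 (List.forall₂_same.2 fun e he => (hg e (hSN e he)).2))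
  have hdel : ∀ z, w ∈ N.val (.inr z) → M.rel.filter (·.1 = z) ⊆ d'.toFinset := by
    rintro z hz ⟨u, y⟩ he
    obtain ⟨huy, rfl⟩ := Finset.mem_filter.1 he
    by_contra hed
    obtain ⟨v', hv'⟩ := (FinModel.of_sat_EF hsat (by rwa [FinModel.delEdges_val])).2.1
      ⟨y, (FinModel.mem_delEdges_rel _ _ _).2 ⟨huy, fun hmem => hed (List.mem_toFinset.2 hmem)⟩⟩
    rw [FinModel.mem_delEdges_rel] at hv'
    exact hv'.2 (by simpa [hS] using hv'.1)
  have hdisj : Disjoint (M.rel.filter (·.1 = x)) (M.rel.filter (·.1 = x')) :=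
    Finset.disjoint_filter.2 fun e _ h1 h2 => hne (h1.symm.trans h2)
  have hcard := Finset.card_le_card (Finset.union_subset (hdel x hx) (hdel x' hx'))
  rw [Finset.card_union_of_disjoint hdisj] at hcard
  have h1 := FinModel.card_filter_fst_le_of_sat_KF h hx
  have h2 := FinModel.card_filter_fst_le_of_sat_KF h hx'
  rw [← hS] at h1 h2
  have h3 := d'.toFinset_card_le
  rw [Finset.length_toList] at hlen
  have hpos : 0 < S.card := Finset.card_pos.2 ⟨(w, v), Finset.mem_filter.2 ⟨hv, rfl⟩⟩
  omega

end CharFormula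

/-- Suppose `M` has `n` edges and `(N',t)` is an expansion of `(N,t)` in which
`K(M)` is globally true and `p_s` holds at `t`.  Then for any sequence
`(j1,…,jl)` of pairwise distinct edges of `N` with `l ≤ n`, any path
`t0 → ⋯ → tk` in `N` with those edges deleted, whose start `t0` is reachable
from `t` in `N`, is matched by a sequence `(d1,…,dl)` of pairwise distinct
edges of `M` — with `p_{d_m(1)}` true at `j_m(1)` and `p_{d_m(2)}` true at
`j_m(2)` in `N'` for each `m` — and a path `s0 → ⋯ → sk` in `M` with those
edges deleted, whose start `s0` is reachable from `s` in `M`, agreeing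
pointwise on all original propositional letters. -/
theorem zag_paths_of_expansion [Fintype α] [DecidableEq α]
    [Fintype β] [DecidableEq β] [Fintype P]
    (M : FinModel α P) (s : α) (N : FinModel β P) (t : β) (f : α → Finset β)
    (hK : ∀ w : β, (N.expand f).Sat w (KF M))
    (hps : (N.expand f).Sat t (.atom (.inr s)))
    (j : List (β × β)) (hjnd : j.Nodup) (hjN : ∀ e ∈ j, e ∈ N.rel)
    (hjl : j.length ≤ M.rel.card)
    (t0 : β) (ts : List β)
    (hpath : (N.delEdges j).IsPath (t0 :: ts))
    (hreach : N.Reach t t0) :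
    ∃ (d : List (α × α)) (s0 : α) (ss : List α),
      d.Nodup ∧ (∀ e ∈ d, e ∈ M.rel) ∧
      List.Forall₂ (fun dm jm => jm.1 ∈ f dm.1 ∧ jm.2 ∈ f dm.2) d j ∧
      (M.delEdges d).IsPath (s0 :: ss) ∧ M.Reach s s0 ∧
      List.Forall₂ (fun a b => ∀ p : P, a ∈ M.val p ↔ b ∈ N.val p)
        (s0 :: ss) (t0 :: ts) := by
  have : Nonempty α := ⟨s⟩
  obtain ⟨g, hg, hinj⟩ := FinModel.exists_edge_map_of_sat_KF (hK t)
  have huniq : ∀ {w v : β} {x : α}, (w, v) ∈ N.rel → w ∈ f x → x = (g (w, v)).1 :=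
    fun {w _ _} hv hx => FinModel.label_unique_of_sat_KF (hK w) hv hx (hg _ hv).2.1
  have hstep : ∀ {w v : β} {x : α}, (w, v) ∈ N.rel → w ∈ f x →
      (x, (g (w, v)).2) = g (w, v) := fun hv hx => Prod.ext (huniq hv hx) rfl
  have hval : ∀ {w : β} {x : α}, w ∈ f x → ∀ p, x ∈ M.val p ↔ w ∈ N.val p :=
    fun {w _} hx => (FinModel.of_sat_EF (hK w).1 hx).1
  have hs0 : ∃ s0, M.Reach s s0 ∧ t0 ∈ f s0 := by
    clear hpath
    induction hreach with
    | refl => exact ⟨s, .refl, hps⟩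
    | @tail w v _ hwv ih =>
      obtain ⟨x, hx, hwx⟩ := ih
      exact ⟨(g (w, v)).2, hx.tail (by rw [hstep hwv hwx]; exact (hg _ hwv).1), (hg _ hwv).2.2⟩
  obtain ⟨s0, hss0, ht0⟩ := hs0
  have hlift : ∃ ss, (M.delEdges (j.map g)).IsPath (s0 :: ss) ∧
      List.Forall₂ (fun a b => ∀ p : P, a ∈ M.val p ↔ b ∈ N.val p) (s0 :: ss) (t0 :: ts) := by
    clear hreach hss0
    induction ts generalizing t0 s0 with
    | nil => exact ⟨[], List.isChain_singleton _, .cons (hval ht0) .nil⟩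
    | cons v ts ih =>
      obtain ⟨hv, hrest⟩ := List.isChain_cons_cons.1 hpath
      rw [FinModel.mem_delEdges_rel] at hv
      obtain ⟨ss, hss, hagree⟩ := ih v hrest (g (t0, v)).2 (hg _ hv.1).2.2
      refine ⟨(g (t0, v)).2 :: ss, List.isChain_cons_cons.2 ⟨?_, hss⟩, .cons (hval ht0) hagree⟩
      rw [hstep hv.1 ht0, FinModel.mem_delEdges_rel]
      refine ⟨(hg _ hv.1).1, fun hmem => ?_⟩
      obtain ⟨e, he, heq⟩ := List.mem_map.1 hmem
      exact hv.2 (hinj (hjN e he) hv.1 heq ▸ he)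
  obtain ⟨ss, hss, hagree⟩ := hlift
  refine ⟨j.map g, s0, ss,
    List.Nodup.map_on (fun e he e' he' => hinj (hjN e he) (hjN e' he')) hjnd, ?_,
    List.forall₂_map_left_iff.2 (List.forall₂_same.2 fun e he => (hg e (hjN e he)).2),
    hss, hss0, hagree⟩
  intro e he
  obtain ⟨e, hej, rfl⟩ := List.mem_map.1 he
  exact (hg e (hjN e hej)).1
end
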